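/- Let α and β be real numbers with α > 1 and β > 1 that are multiplicatively independent. Then the set {α^m / β^n : m, n ∈ ℕ} is dense in the set of positive real numbers; that is, for every real x > 0 and every ε > 0 there exist natural numbers m and n with |α^m / β^n − x| < ε. -/

import Mathlib

/-- If `a / b` is irrational with `a, b > 0`, then the differences `m * a - n * b` with `m n : ℕ`
come arbitrarily close to every real number. -/
theorem exists_nat_mul_sub_nat_mul_near {a b : ℝ} (ha : 0 < a) (hb : 0 < b)
    (hab : Irrational (a / b)) (y : ℝ) {δ : ℝ} (hδ : 0 < δ) :
    ∃ m n : ℕ, |(m * a - n * b : ℝ) - y| < δ := by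
  have hη : 0 < min δ (min a b) := by positivity
  obtain ⟨d, ⟨hd0, hdη⟩, hd⟩ :=
    (dense_addSubgroupClosure_pair_iff.mpr hab).exists_mem_open isOpen_Ioo (Set.nonempty_Ioo.mpr hη)
      |>.imp fun _ h => h.symm
  obtain ⟨p, q, hpq⟩ := AddSubgroup.mem_closure_pair.mp hd
  simp only [zsmul_eq_mul] at hpq
  obtain ⟨hdδ, hda, hdb⟩ : d < δ ∧ d < a ∧ d < b := by simpa using hdη
  rcases lt_trichotomy p 0 with hp | rfl | hp
  · have hq : 0 ≤ q := by
      by_contra! hq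
      have hp' : (p : ℝ) < 0 := by exact_mod_cast hp
      have hq' : (q : ℝ) < 0 := by exact_mod_cast hq
      nlinarith
    obtain ⟨p', rfl⟩ : ∃ p' : ℕ, p = -p' := ⟨p.natAbs, by omega⟩
    lift q to ℕ using hq
    push_cast at hpq
    obtain ⟨M, hM⟩ := exists_nat_ge (y / a)
    rw [div_le_iff₀ ha] at hM
    have hk₁ := Nat.floor_le (div_nonneg (sub_nonneg.mpr hM) hd0.le)
    have hk₂ := Nat.lt_floor_add_one ((M * a - y) / d)
    rw [le_div_iff₀ hd0] at hk₁
    rw [div_lt_iff₀ hd0] at hk₂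
    set k := ⌊(M * a - y) / d⌋₊
    refine ⟨M + k * p', k * q, ?_⟩
    have key : ((M + k * p' : ℕ) * a - (k * q : ℕ) * b : ℝ) = M * a - k * d := by
      rw [← hpq]; push_cast; ring
    rw [key, abs_lt]
    constructor <;> linarith
  · have hq : 0 < q := by
      by_contra! hq
      have hq' : (q : ℝ) ≤ 0 := by exact_mod_cast hq
      push_cast at hpq
      nlinarith
    have hq' : (1 : ℝ) ≤ q := by exact_mod_cast hq
    push_cast at hpq
    nlinarith
  · have hp' : (1 : ℝ) ≤ p := by exact_mod_cast hp
    have hq : q ≤ 0 := by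
      by_contra! hq
      have hq' : (0 : ℝ) < q := by exact_mod_cast hq
      nlinarith
    obtain ⟨q', rfl⟩ : ∃ q' : ℕ, q = -q' := ⟨q.natAbs, by omega⟩
    lift p to ℕ using hp.le
    push_cast at hpq
    obtain ⟨N, hN⟩ := exists_nat_ge (-y / b)
    rw [div_le_iff₀ hb] at hN
    have hk₁ := Nat.floor_le (div_nonneg (by linarith : 0 ≤ y + N * b) hd0.le)
    have hk₂ := Nat.lt_floor_add_one ((y + N * b) / d)
    rw [le_div_iff₀ hd0] at hk₁
    rw [div_lt_iff₀ hd0] at hk₂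
    set k := ⌊(y + N * b) / d⌋₊
    refine ⟨k * p, N + k * q', ?_⟩
    have key : ((k * p : ℕ) * a - (N + k * q' : ℕ) * b : ℝ) = k * d - N * b := by
      rw [← hpq]; push_cast; ring
    rw [key, abs_lt]
    constructor <;> linarith

/-- The ratio of the logarithms of multiplicatively independent reals `> 1` is irrational. -/
theorem irrational_log_div_log_of_mul_independent {α β : ℝ} (hα : 1 < α) (hβ : 1 < β)
    (hindep : ∀ m n : ℤ, α ^ m = β ^ n → m = 0 ∧ n = 0) :
    Irrational (Real.log α / Real.log β) := by
  rintro ⟨r, hr⟩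
  have hα₀ : 0 < α := by linarith
  have hβ₀ : 0 < β := by linarith
  have hden : (r.den : ℝ) ≠ 0 := by exact_mod_cast r.den_ne_zero
  rw [Rat.cast_def, div_eq_div_iff hden (Real.log_pos hβ).ne'] at hr
  have h := hindep r.den r.num <| Real.log_injOn_pos (zpow_pos hα₀ _) (zpow_pos hβ₀ _) <| by
    rw [Real.log_zpow, Real.log_zpow, hr, Int.cast_natCast, mul_comm]
  exact r.den_ne_zero (by exact_mod_cast h.1)

/-- If `α, β > 1` are multiplicatively independent, then `{α^m / β^n : m n : ℕ}`
is dense in the positive reals. -/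
theorem adalrs_scaling_factors_dense_in_positive_reals
    (α β : ℝ) (hα : 1 < α) (hβ : 1 < β)
    (hindep : ∀ m n : ℤ, α ^ m = β ^ n → m = 0 ∧ n = 0) :
    ∀ x : ℝ, 0 < x → ∀ ε : ℝ, 0 < ε →
      ∃ m n : ℕ, |α ^ m / β ^ n - x| < ε := by
  intro x hx ε hε
  obtain ⟨δ, hδ, hexp⟩ :=
    Metric.continuousAt_iff.mp (Real.continuous_exp.continuousAt (x := Real.log x)) ε hε
  obtain ⟨m, n, hmn⟩ := exists_nat_mul_sub_nat_mul_near (Real.log_pos hα) (Real.log_pos hβ)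
    (irrational_log_div_log_of_mul_independent hα hβ hindep) (Real.log x) hδ
  refine ⟨m, n, ?_⟩
  have h := hexp (by rwa [Real.dist_eq])
  rwa [Real.dist_eq, Real.exp_log hx, Real.exp_sub, Real.exp_nat_mul, Real.exp_nat_mul,
    Real.exp_log (by linarith), Real.exp_log (by linarith)] at h
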